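/- arXiv:2603.27795 — 2 statements merged into one kernel-verified Lean document; each statement's English description precedes it below -/
import Mathlib

section
/- For a set A ⊆ V, let g(A) be the random variable g(A) = |A| + |MVC(G*[V \ A])|, where G*[V \ A] is the induced subgraph of the realized graph G* on V \ A. Then for any set S ⊆ V and any ε ∈ [0,1], Pr[|g(S) − E[g(S)]| > ε·E[g(S)]] ≤ 2·exp(−ε²·opt/66). -/
open Finset

noncomputable section
open scoped Classical

variable {V : Type*} [Fintype V] [DecidableEq V]

/-- The probability that the realized graph `G* ~ G_p` (each edge of the base edge set `E`
kept independently with probability `p`) has edge set exactly `F`. -/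
def edgeWeight (p : ℝ) (E F : Finset (Sym2 V)) : ℝ :=
  p ^ F.card * (1 - p) ^ (E \ F).card

/-- The probability of an event `A` of the realized graph `G* ~ G_p`, where `E` is the
edge set of the base graph. -/
def probEvent (p : ℝ) (E : Finset (Sym2 V)) (A : Finset (Sym2 V) → Prop) : ℝ :=
  ∑ F ∈ E.powerset, if A F then edgeWeight p E F else 0

/-- The expectation of a real-valued function of the realized graph `G* ~ G_p`. -/
def expVal (p : ℝ) (E : Finset (Sym2 V)) (X : Finset (Sym2 V) → ℝ) : ℝ :=
  ∑ F ∈ E.powerset, edgeWeight p E F * X F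

/-- `C` is a vertex cover of the graph with edge set `F`. -/
def IsCoverOf (C : Finset V) (F : Finset (Sym2 V)) : Prop :=
  ∀ e ∈ F, ∃ v ∈ C, v ∈ e

/-- `MVC` assigns to every spanning subgraph of the base graph (given by its edge set
`F ⊆ E`) a vertex cover of minimum size. -/
def IsMinCoverFn (E : Finset (Sym2 V)) (MVC : Finset (Sym2 V) → Finset V) : Prop :=
  ∀ F ⊆ E, IsCoverOf (MVC F) F ∧ ∀ C : Finset V, IsCoverOf C F → (MVC F).card ≤ C.card

/-- `opt = E[|MVC(G*)|]`. -/
def optVal (p : ℝ) (E : Finset (Sym2 V)) (MVC : Finset (Sym2 V) → Finset V) : ℝ :=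
  expVal p E fun F => ((MVC F).card : ℝ)

/-- The number of edges of the induced subgraph `G[V \ S]` of the base graph. -/
def inducedEdgeCount (G : SimpleGraph V) [DecidableRel G.Adj] (S : Finset V) : ℕ :=
  (G.edgeFinset.filter fun e => ∀ v ∈ e, v ∉ S).card

set_option linter.unusedSectionVars false

lemma expVal_split (p : ℝ) (A B : Finset (Sym2 V)) (h : Disjoint A B)
    (X : Finset (Sym2 V) → ℝ) :
    expVal p (A ∪ B) X = expVal p B (fun K => expVal p A (fun F => X (F ∪ K))) := by
  unfold expVal
  simp only [Finset.mul_sum]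
  rw [← Finset.sum_product']
  symm
  refine Finset.sum_bij' (fun x _ => x.2 ∪ x.1) (fun F _ => (F ∩ B, F ∩ A)) ?_ ?_ ?_ ?_ ?_
  · rintro ⟨K, F⟩ hx
    simp only [Finset.mem_product, Finset.mem_powerset] at hx ⊢
    exact Finset.union_subset_union hx.2 hx.1
  · intro F hF
    simp
  · rintro ⟨K, F⟩ hx
    simp only [Finset.mem_product, Finset.mem_powerset] at hx
    rw [Finset.disjoint_left] at h
    ext e <;> simp <;> grind
  · intro F hF
    simp only [Finset.mem_powerset] at hF
    ext e
    grind
  · rintro ⟨K, F⟩ hx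
    simp only [Finset.mem_product, Finset.mem_powerset] at hx
    have h1 : (F ∪ K).card = F.card + K.card :=
      Finset.card_union_of_disjoint (Finset.disjoint_of_subset_left hx.2
        (Finset.disjoint_of_subset_right hx.1 h))
    have h2 : (A ∪ B) \ (F ∪ K) = (A \ F) ∪ (B \ K) := by
      rw [Finset.disjoint_left] at h
      ext e
      grind
    have h3 : ((A ∪ B) \ (F ∪ K)).card = (A \ F).card + (B \ K).card := by
      rw [h2]
      exact Finset.card_union_of_disjoint (Finset.disjoint_of_subset_left Finset.sdiff_subset
        (Finset.disjoint_of_subset_right Finset.sdiff_subset h))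
    simp only [edgeWeight, h1, h3, pow_add]
    ring

lemma edgeWeight_nonneg' {p : ℝ} (hp0 : 0 ≤ p) (hp1 : p ≤ 1) (E F : Finset (Sym2 V)) :
    0 ≤ edgeWeight p E F := by
  have : 0 ≤ 1 - p := by linarith
  unfold edgeWeight
  positivity

lemma expVal_mono {p : ℝ} (hp0 : 0 ≤ p) (hp1 : p ≤ 1) (E : Finset (Sym2 V))
    {X Y : Finset (Sym2 V) → ℝ} (h : ∀ F ⊆ E, X F ≤ Y F) : expVal p E X ≤ expVal p E Y :=
  Finset.sum_le_sum fun F hF =>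
    mul_le_mul_of_nonneg_left (h F (Finset.mem_powerset.1 hF)) (edgeWeight_nonneg' hp0 hp1 E F)

lemma expVal_congr {p : ℝ} (E : Finset (Sym2 V))
    {X Y : Finset (Sym2 V) → ℝ} (h : ∀ F ⊆ E, X F = Y F) : expVal p E X = expVal p E Y :=
  Finset.sum_congr rfl fun F hF => by rw [h F (Finset.mem_powerset.1 hF)]

lemma expVal_const (p : ℝ) (E : Finset (Sym2 V)) (c : ℝ) : expVal p E (fun _ => c) = c := by
  unfold expVal edgeWeight
  rw [← Finset.sum_mul]
  have : ∑ F ∈ E.powerset, p ^ F.card * (1 - p) ^ (E \ F).card = 1 := by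
    have h := Finset.sum_pow_mul_eq_add_pow p (1 - p) E
    rw [show p + (1 - p) = 1 by ring, one_pow] at h
    refine Eq.trans (Finset.sum_congr rfl fun F hF => ?_) h
    rw [Finset.card_sdiff_of_subset (Finset.mem_powerset.1 hF)]
  rw [this, one_mul]

lemma expVal_add (p : ℝ) (E : Finset (Sym2 V)) (X Y : Finset (Sym2 V) → ℝ) :
    expVal p E (fun F => X F + Y F) = expVal p E X + expVal p E Y := by
  simp only [expVal, mul_add, Finset.sum_add_distrib]

lemma expVal_sub (p : ℝ) (E : Finset (Sym2 V)) (X Y : Finset (Sym2 V) → ℝ) :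
    expVal p E (fun F => X F - Y F) = expVal p E X - expVal p E Y := by
  simp only [expVal, mul_sub, Finset.sum_sub_distrib]

lemma expVal_smul (p : ℝ) (E : Finset (Sym2 V)) (c : ℝ) (X : Finset (Sym2 V) → ℝ) :
    expVal p E (fun F => c * X F) = c * expVal p E X := by
  simp only [expVal, Finset.mul_sum]
  exact Finset.sum_congr rfl fun F _ => by ring

lemma expVal_mul_const (p : ℝ) (E : Finset (Sym2 V)) (c : ℝ) (X : Finset (Sym2 V) → ℝ) :
    expVal p E (fun F => X F * c) = expVal p E X * c := by
  simp only [expVal, Finset.sum_mul]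
  exact Finset.sum_congr rfl fun F _ => by ring

lemma expVal_finset_sum {ι : Type*} (p : ℝ) (E : Finset (Sym2 V)) (W : Finset ι)
    (X : ι → Finset (Sym2 V) → ℝ) :
    expVal p E (fun F => ∑ v ∈ W, X v F) = ∑ v ∈ W, expVal p E (X v) := by
  simp only [expVal, Finset.mul_sum]
  exact Finset.sum_comm

lemma expVal_pos {p : ℝ} (hp0 : 0 ≤ p) (hp1 : p ≤ 1) (E : Finset (Sym2 V))
    {X : Finset (Sym2 V) → ℝ} (h : ∀ F, 0 < X F) : 0 < expVal p E X := by
  obtain ⟨F0, _, h0⟩ := Finset.exists_min_image E.powerset X ⟨∅, by simp⟩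
  calc 0 < X F0 := h F0
    _ = expVal p E (fun _ => X F0) := (expVal_const p E _).symm
    _ ≤ _ := expVal_mono hp0 hp1 E fun F hF => h0 F (Finset.mem_powerset.2 hF)

lemma ent_step {p : ℝ} (hp0 : 0 ≤ p) (hp1 : p ≤ 1) (A B : Finset (Sym2 V))
    (f : Finset (Sym2 V) → Finset (Sym2 V) → ℝ) (hf : ∀ K F, 0 < f K F)
    (g : Finset (Sym2 V) → ℝ) (hg : ∀ F, 0 < g F) :
    expVal p B (fun K => expVal p A (f K) * Real.log (expVal p A (f K)))
      - expVal p B (fun K => expVal p A (f K)) *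
        Real.log (expVal p B (fun K => expVal p A (f K))) ≤
    expVal p B (fun K => expVal p A (fun F =>
      f K F * (Real.log (f K F) - Real.log (g F)) - f K F + g F)) := by
  set h : Finset (Sym2 V) → ℝ := fun K => expVal p A (f K) with hh
  have hpos : ∀ K, 0 < h K := fun K => expVal_pos hp0 hp1 A (hf K)
  set m := expVal p B h with hm
  have mpos : 0 < m := expVal_pos hp0 hp1 B hpos
  have key : ∀ K F, f K F * (Real.log (h K) - Real.log m) + (f K F - g F * (h K / m)) + g F - f K F
      ≤ f K F * (Real.log (f K F) - Real.log (g F)) - f K F + g F := by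
    intro K F
    have hu : 0 < g F * (h K / m) := mul_pos (hg F) (div_pos (hpos K) mpos)
    have h1 := Real.log_le_sub_one_of_pos (div_pos hu (hf K F))
    rw [Real.log_div hu.ne' (hf K F).ne', Real.log_mul (hg F).ne' (div_pos (hpos K) mpos).ne',
      Real.log_div (hpos K).ne' mpos.ne'] at h1
    have h2 := mul_le_mul_of_nonneg_left h1 (hf K F).le
    have h3 : f K F * (g F * (h K / m) / f K F - 1) = g F * (h K / m) - f K F := by
      have := (hf K F).ne'
      field_simp
    rw [h3] at h2
    linarith
  have h4 := expVal_mono hp0 hp1 B (fun K _ => expVal_mono hp0 hp1 A (fun F _ => key K F))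
  refine le_trans (le_of_eq ?_) h4
  have e1 : ∀ K, expVal p A (fun F => f K F * (Real.log (h K) - Real.log m)
      + (f K F - g F * (h K / m)) + g F - f K F)
      = (h K * Real.log (h K)) - h K * Real.log m - h K * (expVal p A g / m) + expVal p A g := by
    intro K
    rw [expVal_sub, expVal_add, expVal_add, expVal_sub, expVal_mul_const, expVal_mul_const]
    simp only [hh]
    ring
  simp only [e1]
  rw [expVal_add, expVal_sub, expVal_sub, expVal_mul_const, expVal_mul_const, expVal_const, ← hm]
  field_simp
  ring

lemma ent_tensor {p : ℝ} (hp0 : 0 ≤ p) (hp1 : p ≤ 1) (E : Finset (Sym2 V)) (own : Sym2 V → V)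
    (W : Finset V) : ∀ (f : Finset (Sym2 V) → ℝ) (_ : ∀ F, 0 < f F)
    (g : V → Finset (Sym2 V) → ℝ) (_ : ∀ v F, 0 < g v F)
    (_ : ∀ v F K, (∀ e ∈ K, own e = v) → g v (F ∪ K) = g v F),
    expVal p (E.filter fun e => own e ∈ W) (fun F => f F * Real.log (f F))
      - expVal p (E.filter fun e => own e ∈ W) f *
        Real.log (expVal p (E.filter fun e => own e ∈ W) f) ≤
    ∑ v ∈ W, expVal p (E.filter fun e => own e ∈ W) (fun F =>
      f F * (Real.log (f F) - Real.log (g v F)) - f F + g v F) := by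
  induction W using Finset.induction_on with
  | empty =>
    intro f hf g hg hi
    simp [expVal, edgeWeight]
  | insert j W hj ih =>
    intro f hf g hg hi
    have hE : (E.filter fun e => own e ∈ insert j W) =
        (E.filter fun e => own e ∈ W) ∪ (E.filter fun e => own e = j) := by
      ext e
      simp only [Finset.mem_filter, Finset.mem_union, Finset.mem_insert]
      tauto
    have hd : Disjoint (E.filter fun e => own e ∈ W) (E.filter fun e => own e = j) := by
      rw [Finset.disjoint_left]
      intro e h1 h2
      simp only [Finset.mem_filter] at h1 h2
      exact hj (h2.2 ▸ h1.2)
    rw [hE]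
    simp only [expVal_split p _ _ hd]
    set A := E.filter fun e => own e ∈ W
    set B := E.filter fun e => own e = j with hB
    rw [Finset.sum_insert hj]
    have s1 := ent_step hp0 hp1 A B (fun K F => f (F ∪ K)) (fun K F => hf _) (g j) (hg j)
    have s2 : expVal p B (fun K => expVal p A (fun F => f (F ∪ K) * Real.log (f (F ∪ K)))
        - expVal p A (fun F => f (F ∪ K)) * Real.log (expVal p A (fun F => f (F ∪ K)))) ≤
        expVal p B (fun K => ∑ v ∈ W, expVal p A (fun F =>
          f (F ∪ K) * (Real.log (f (F ∪ K)) - Real.log (g v (F ∪ K))) - f (F ∪ K) + g v (F ∪ K))) := by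
      refine expVal_mono hp0 hp1 B fun K _ => ?_
      refine ih (fun F => f (F ∪ K)) (fun F => hf _) (fun v F => g v (F ∪ K)) (fun v F => hg _ _) ?_
      intro v F K' hK'
      rw [Finset.union_right_comm, hi v _ K' hK']
    rw [expVal_sub, expVal_finset_sum] at s2
    have s3 : expVal p B (fun K => expVal p A (fun F =>
          f (F ∪ K) * (Real.log (f (F ∪ K)) - Real.log (g j (F ∪ K))) - f (F ∪ K) + g j (F ∪ K)))
        = expVal p B (fun K => expVal p A (fun F =>
          f (F ∪ K) * (Real.log (f (F ∪ K)) - Real.log (g j F)) - f (F ∪ K) + g j F)) := by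
      refine expVal_congr B fun K hK => expVal_congr A fun F _ => ?_
      rw [hi j F K (fun e he => (Finset.mem_filter.1 (hK he)).2)]
    rw [s3]
    linarith

/-- Vertices outside `C` contained in some minimum cover satisfy Hall's condition into `C`. -/
lemma hall_aux (H : Finset (Sym2 V)) (C : Finset V) (hC : IsCoverOf C H) (n : ℕ) :
    ∀ A : Finset V, A.card = n → Disjoint A C →
    (∀ a ∈ A, ∃ D : Finset V, IsCoverOf D H ∧ a ∈ D ∧
      ∀ D' : Finset V, IsCoverOf D' H → D.card ≤ D'.card) →
    A.card ≤ (C.filter fun c => ∃ a ∈ A, s(a, c) ∈ H).card := by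
  induction n using Nat.strong_induction_on with
  | _ n ih =>
  intro A hn hAC hA
  rcases A.eq_empty_or_nonempty with rfl | ⟨a, ha⟩
  · simp
  obtain ⟨D, hD, haD, hmin⟩ := hA a ha
  have hlt : (A \ D).card < n := by
    rw [← hn]
    exact Finset.card_lt_card ⟨Finset.sdiff_subset, fun h => (Finset.mem_sdiff.1 (h ha)).2 haD⟩
  have h1 := ih _ hlt (A \ D) rfl (Finset.disjoint_of_subset_left Finset.sdiff_subset hAC)
    (fun b hb => hA b (Finset.mem_sdiff.1 hb).1)
  set N := C.filter fun c => ∃ a ∈ A, s(a, c) ∈ H with hN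
  set N' := C.filter fun c => ∃ a ∈ A \ D, s(a, c) ∈ H with hN'
  have hsub : N' ⊆ N ∩ D := by
    intro c hc
    simp only [hN', hN, Finset.mem_filter, Finset.mem_inter, Finset.mem_sdiff] at hc ⊢
    obtain ⟨hcC, b, ⟨hbA, hbD⟩, hbc⟩ := hc
    refine ⟨⟨hcC, b, hbA, hbc⟩, ?_⟩
    obtain ⟨v, hv, hve⟩ := hD _ hbc
    rcases Sym2.mem_iff.1 hve with rfl | rfl
    · exact absurd hv hbD
    · exact hv
  have hcov : IsCoverOf ((D \ A) ∪ (N \ D)) H := by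
    intro e he
    obtain ⟨v, hv, hve⟩ := hD e he
    by_cases hvA : v ∈ A
    · obtain ⟨c, hc, hce⟩ := hC e he
      have hcA : c ∉ A := fun h => Finset.disjoint_left.1 hAC h hc
      have hne : v ≠ c := fun h => hcA (h ▸ hvA)
      have hee : e = s(v, c) := (Sym2.mem_and_mem_iff hne).1 ⟨hve, hce⟩
      refine ⟨c, ?_, hce⟩
      by_cases hcD : c ∈ D
      · simp [hcD, hcA]
      · have : c ∈ N := by
          simp only [hN, Finset.mem_filter]
          exact ⟨hc, v, hvA, hee ▸ he⟩
        simp [hcD, this]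
    · exact ⟨v, by simp [hv, hvA], hve⟩
  have h2 := hmin _ hcov
  have h3 := Finset.card_union_le (D \ A) (N \ D)
  have h4 := Finset.card_le_card hsub
  have h5 := Finset.card_sdiff_add_card_inter D A
  have h6 := Finset.card_sdiff_add_card_inter A D
  have h7 := Finset.card_sdiff_add_card_inter N D
  rw [Finset.inter_comm] at h5
  omega

lemma union_min_covers (H : Finset (Sym2 V)) (C : Finset V) (hC : IsCoverOf C H) (U : Finset V)
    (hU : ∀ a ∈ U, ∃ D : Finset V, IsCoverOf D H ∧ a ∈ D ∧
      ∀ D' : Finset V, IsCoverOf D' H → D.card ≤ D'.card) : U.card ≤ 2 * C.card := by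
  have h1 := hall_aux H C hC _ (U \ C) rfl Finset.sdiff_disjoint
    (fun a ha => hU a (Finset.mem_sdiff.1 ha).1)
  have h2 := Finset.card_filter_le C (fun c => ∃ a ∈ U \ C, s(a, c) ∈ H)
  have h3 := Finset.card_sdiff_add_card_inter U C
  have h4 := Finset.card_le_card (Finset.inter_subset_right : U ∩ C ⊆ C)
  omega

lemma self_bounding (E : Finset (Sym2 V)) (MVC : Finset (Sym2 V) → Finset V)
    (hM : IsMinCoverFn E MVC) (own : Sym2 V → V) (hown : ∀ e, own e ∈ e)
    (H : Finset (Sym2 V)) (hH : H ⊆ E) :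
    (∀ v, (MVC (H.filter fun e => own e ≠ v)).card ≤ (MVC H).card ∧
      (MVC H).card ≤ (MVC (H.filter fun e => own e ≠ v)).card + 1) ∧
    ∑ v : V, (((MVC H).card : ℝ) - ((MVC (H.filter fun e => own e ≠ v)).card : ℝ)) ≤
      2 * ((MVC H).card : ℝ) := by
  have hsub : ∀ v, (H.filter fun e => own e ≠ v) ⊆ E :=
    fun v => (Finset.filter_subset _ _).trans hH
  have hcov : ∀ v, IsCoverOf (insert v (MVC (H.filter fun e => own e ≠ v))) H := by
    intro v e he
    by_cases h : own e = v
    · exact ⟨v, by simp, h ▸ hown e⟩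
    · obtain ⟨w, hw, hwe⟩ := (hM _ (hsub v)).1 e (by simp [he, h])
      exact ⟨w, by simp [hw], hwe⟩
  have hb : ∀ v, (MVC (H.filter fun e => own e ≠ v)).card ≤ (MVC H).card ∧
      (MVC H).card ≤ (MVC (H.filter fun e => own e ≠ v)).card + 1 := by
    intro v
    constructor
    · exact (hM _ (hsub v)).2 _ fun e he => (hM H hH).1 e (Finset.mem_filter.1 he).1
    · exact ((hM H hH).2 _ (hcov v)).trans (Finset.card_insert_le _ _)
  refine ⟨hb, ?_⟩
  set U : Finset V := Finset.univ.filter fun v =>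
    (MVC (H.filter fun e => own e ≠ v)).card < (MVC H).card with hUdef
  have hU := union_min_covers H (MVC H) (hM H hH).1 U (by
    intro v hv
    have hv' := (Finset.mem_filter.1 hv).2
    refine ⟨_, hcov v, by simp, fun D' hD' => ?_⟩
    have h1 := (hM H hH).2 D' hD'
    have h2 := Finset.card_insert_le v (MVC (H.filter fun e => own e ≠ v))
    omega)
  calc ∑ v : V, (((MVC H).card : ℝ) - ((MVC (H.filter fun e => own e ≠ v)).card : ℝ))
      ≤ ∑ v : V, (if v ∈ U then (1 : ℝ) else 0) := by
        refine Finset.sum_le_sum fun v _ => ?_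
        split_ifs with h
        · have : ((MVC H).card : ℝ) ≤ ((MVC (H.filter fun e => own e ≠ v)).card : ℝ) + 1 := by
            exact_mod_cast (hb v).2
          linarith
        · have : ¬ (MVC (H.filter fun e => own e ≠ v)).card < (MVC H).card := by
            intro h'
            exact h (by simp only [hUdef, Finset.mem_filter, Finset.mem_univ, true_and]; exact h')
          have : ((MVC H).card : ℝ) ≤ ((MVC (H.filter fun e => own e ≠ v)).card : ℝ) := by
            exact_mod_cast not_lt.1 this
          linarith
    _ = (U.card : ℝ) := by simp
    _ ≤ _ := by exact_mod_cast hU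

/-- Entropy bound for a self-bounding function. -/
lemma ent_bound {p : ℝ} (hp0 : 0 ≤ p) (hp1 : p ≤ 1) (E : Finset (Sym2 V)) (own : Sym2 V → V)
    (Z : Finset (Sym2 V) → ℝ)
    (hb : ∀ F ⊆ E, ∀ v, Z (F.filter fun e => own e ≠ v) ≤ Z F ∧
      Z F ≤ Z (F.filter fun e => own e ≠ v) + 1)
    (hs : ∀ F ⊆ E, ∑ v : V, (Z F - Z (F.filter fun e => own e ≠ v)) ≤ 2 * Z F)
    (t : ℝ) :
    t * expVal p E (fun F => Z F * Real.exp (t * Z F))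
      - expVal p E (fun F => Real.exp (t * Z F)) *
        Real.log (expVal p E (fun F => Real.exp (t * Z F))) ≤
    2 * (Real.exp (-t) + t - 1) * expVal p E (fun F => Z F * Real.exp (t * Z F)) := by
  have h := ent_tensor hp0 hp1 E own Finset.univ (fun F => Real.exp (t * Z F))
    (fun F => Real.exp_pos _) (fun v F => Real.exp (t * Z (F.filter fun e => own e ≠ v)))
    (fun v F => Real.exp_pos _) (by
      intro v F K hK
      have : (F ∪ K).filter (fun e => own e ≠ v) = F.filter (fun e => own e ≠ v) := by
        ext e
        simp only [Finset.mem_filter, Finset.mem_union]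
        constructor
        · rintro ⟨h1 | h1, h2⟩
          · exact ⟨h1, h2⟩
          · exact absurd (hK e h1) h2
        · rintro ⟨h1, h2⟩
          exact ⟨Or.inl h1, h2⟩
      simp only [this])
  simp only [Finset.mem_univ, Finset.filter_true, Real.log_exp] at h
  have e1 : expVal p E (fun F => Real.exp (t * Z F) * (t * Z F))
      = t * expVal p E (fun F => Z F * Real.exp (t * Z F)) := by
    rw [← expVal_smul]
    exact expVal_congr E fun F _ => by ring
  rw [e1] at h
  refine h.trans ?_
  rw [← expVal_finset_sum, ← expVal_smul]
  refine expVal_mono hp0 hp1 E fun F hF => ?_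
  have hphi : 0 ≤ Real.exp (-t) + t - 1 := by
    have := Real.add_one_le_exp (-t)
    linarith
  calc _ ≤ ∑ v : V, (Real.exp (t * Z F) * (Real.exp (-t) + t - 1)) *
        (Z F - Z (F.filter fun e => own e ≠ v)) := by
        refine Finset.sum_le_sum fun v _ => ?_
        obtain ⟨h1, h2⟩ := hb F hF v
        set u := Z F - Z (F.filter fun e => own e ≠ v) with hu
        have hz : Z (F.filter fun e => own e ≠ v) = Z F - u := by rw [hu]; ring
        have hc := convexOn_exp.2 (Set.mem_univ (-t)) (Set.mem_univ 0)
          (show 0 ≤ u by linarith) (show 0 ≤ 1 - u by linarith) (by ring)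
        simp only [smul_eq_mul, mul_zero, add_zero, Real.exp_zero, mul_one] at hc
        rw [hz, show t * (Z F - u) = t * Z F + u * -t by ring, Real.exp_add]
        have := mul_le_mul_of_nonneg_left hc (Real.exp_pos (t * Z F)).le
        linarith
    _ = (Real.exp (t * Z F) * (Real.exp (-t) + t - 1)) *
        ∑ v : V, (Z F - Z (F.filter fun e => own e ≠ v)) := by rw [Finset.mul_sum]
    _ ≤ (Real.exp (t * Z F) * (Real.exp (-t) + t - 1)) * (2 * Z F) :=
        mul_le_mul_of_nonneg_left (hs F hF) (mul_nonneg (Real.exp_pos _).le hphi)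
    _ = _ := by ring


lemma herbst_abs (F F1 : ℝ → ℝ) (hd : ∀ t, HasDerivAt F (F1 t) t) (hF : ∀ t, 0 < F t)
    (hF1 : ∀ t, 0 ≤ F1 t) (h0 : F 0 = 1)
    (hent : ∀ t, t * F1 t - F t * Real.log (F t) ≤ 2 * (Real.exp (-t) + t - 1) * F1 t)
    (s : ℝ) (hs0 : 0 < s) (hs1 : s ≤ 1 / 8) :
    Real.log (F s) ≤ s * F1 0 + 8 / 3 * s ^ 2 * F1 0 ∧
    Real.log (F (-s)) ≤ - s * F1 0 + 8 / 3 * s ^ 2 * F1 0 := by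
  set L : ℝ → ℝ := fun t => Real.log (F t) with hL
  have hLd : ∀ t, HasDerivAt L (F1 t / F t) t := fun t => (hd t).log (hF t).ne'
  have hL0 : L 0 = 0 := by simp [hL, h0]
  have hLe : ∀ t, |t| ≤ 1 → t * (F1 t / F t) - L t ≤ 2 * t ^ 2 * (F1 t / F t) := by
    intro t ht
    have h1 := Real.abs_exp_sub_one_sub_id_le (x := -t) (by simpa using ht)
    have h2 := (abs_le.1 h1).2
    have h3 := hent t
    have h4 : 2 * (Real.exp (-t) + t - 1) * F1 t ≤ 2 * t ^ 2 * F1 t :=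
      mul_le_mul_of_nonneg_right (by nlinarith) (hF1 t)
    have h5 : t * (F1 t / F t) - L t = (t * F1 t - F t * Real.log (F t)) / F t := by
      have := (hF t).ne'
      simp only [hL]
      field_simp
    rw [h5, ← mul_div_assoc]
    exact div_le_div_of_nonneg_right (h3.trans h4) (hF t).le
  set K : ℝ → ℝ := fun t => L t / t - 2 * L t with hK
  have hKd : ∀ t, t ≠ 0 → HasDerivAt K
      ((F1 t / F t * t - L t * 1) / t ^ 2 - 2 * (F1 t / F t)) t := fun t ht =>
    ((hLd t).div (hasDerivAt_id t) ht).sub ((hLd t).const_mul 2)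
  have hKn : ∀ t, t ≠ 0 → |t| ≤ 1 → deriv K t ≤ 0 := by
    intro t ht h1
    rw [(hKd t ht).deriv, sub_nonpos, div_le_iff₀ (by positivity)]
    have := hLe t h1
    linarith
  have hlim : Filter.Tendsto K (nhdsWithin 0 {0}ᶜ) (nhds (F1 0)) := by
    have h1 := hasDerivAt_iff_tendsto_slope.1 (hLd 0)
    have h2 : Filter.Tendsto L (nhdsWithin 0 {0}ᶜ) (nhds (L 0)) :=
      (hLd 0).continuousAt.tendsto.mono_left nhdsWithin_le_nhds
    have h3 := h1.sub (h2.const_mul 2)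
    rw [h0, hL0, div_one, mul_zero, sub_zero] at h3
    refine h3.congr fun t => ?_
    simp [hK, slope_def_field, hL0]
  have hm := hF1 0
  have hanti1 : AntitoneOn K (Set.Ioc 0 1) := by
    refine antitoneOn_of_deriv_nonpos (convex_Ioc 0 1) ?_ ?_ ?_
    · exact fun t ht => (hKd t ht.1.ne').continuousAt.continuousWithinAt
    · intro t ht
      rw [interior_Ioc] at ht
      exact (hKd t ht.1.ne').differentiableAt.differentiableWithinAt
    · intro t ht
      rw [interior_Ioc] at ht
      exact hKn t ht.1.ne' (abs_le.2 ⟨by linarith [ht.1], ht.2.le⟩)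
  have hanti2 : AntitoneOn K (Set.Ico (-1) 0) := by
    refine antitoneOn_of_deriv_nonpos (convex_Ico (-1) 0) ?_ ?_ ?_
    · exact fun t ht => (hKd t ht.2.ne).continuousAt.continuousWithinAt
    · intro t ht
      rw [interior_Ico] at ht
      exact (hKd t ht.2.ne).differentiableAt.differentiableWithinAt
    · intro t ht
      rw [interior_Ico] at ht
      exact hKn t ht.2.ne (abs_le.2 ⟨ht.1.le, by linarith [ht.2]⟩)
  have k1 : K s ≤ F1 0 := by
    have hl : Filter.Tendsto K (nhdsWithin 0 (Set.Ioi 0)) (nhds (F1 0)) :=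
      hlim.mono_left (nhdsWithin_mono _ fun x hx => ne_of_gt hx)
    refine ge_of_tendsto hl ?_
    filter_upwards [Ioo_mem_nhdsGT hs0] with t ht
    exact hanti1 ⟨ht.1, by linarith [ht.2]⟩ ⟨hs0, by linarith⟩ ht.2.le
  have k2 : F1 0 ≤ K (-s) := by
    have hl : Filter.Tendsto K (nhdsWithin 0 (Set.Iio 0)) (nhds (F1 0)) :=
      hlim.mono_left (nhdsWithin_mono _ fun x hx => ne_of_lt hx)
    refine le_of_tendsto hl ?_
    filter_upwards [Ioo_mem_nhdsLT (show -s < 0 by linarith)] with t ht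
    exact hanti2 ⟨by linarith, by linarith⟩ ⟨by linarith [ht.1], ht.2⟩ ht.1.le
  set m := F1 0
  constructor
  · change L s ≤ _
    have e : L s = s / (1 - 2 * s) * K s := by
      have h1 : (1 - 2 * s) ≠ 0 := by linarith
      have h2 : K s = L s * (1 - 2 * s) / s := by
        simp only [hK]
        field_simp
      rw [h2, div_mul_div_comm, eq_div_iff (mul_ne_zero h1 hs0.ne')]
      ring
    have e2 : s / (1 - 2 * s) ≤ s + 8 / 3 * s ^ 2 := by
      rw [div_le_iff₀ (by linarith)]
      nlinarith [mul_nonneg (sq_nonneg s) (show 0 ≤ 1 / 8 - s by linarith)]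
    calc L s = s / (1 - 2 * s) * K s := e
      _ ≤ s / (1 - 2 * s) * m :=
        mul_le_mul_of_nonneg_left k1 (div_nonneg hs0.le (by linarith))
      _ ≤ (s + 8 / 3 * s ^ 2) * m := mul_le_mul_of_nonneg_right e2 hm
      _ = _ := by ring
  · change L (-s) ≤ _
    have e : L (-s) = - (s / (1 + 2 * s)) * K (-s) := by
      have : (1 + 2 * s) ≠ 0 := by linarith
      simp only [hK]
      field_simp
      ring
    have e2 : s - 8 / 3 * s ^ 2 ≤ s / (1 + 2 * s) := by
      rw [le_div_iff₀ (by linarith)]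
      nlinarith [pow_pos hs0 3, sq_nonneg s]
    calc L (-s) = - (s / (1 + 2 * s)) * K (-s) := e
      _ ≤ - (s / (1 + 2 * s)) * m :=
        mul_le_mul_of_nonpos_left k2 (by
          have := div_nonneg hs0.le (show 0 ≤ 1 + 2 * s by linarith)
          linarith)
      _ ≤ -(s - 8 / 3 * s ^ 2) * m := mul_le_mul_of_nonneg_right (by linarith) hm
      _ = _ := by ring

lemma mgf_hasDerivAt (p : ℝ) (E : Finset (Sym2 V)) (Z : Finset (Sym2 V) → ℝ) (t : ℝ) :
    HasDerivAt (fun t => expVal p E (fun F => Real.exp (t * Z F)))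
      (expVal p E (fun F => Z F * Real.exp (t * Z F))) t := by
  unfold expVal
  refine HasDerivAt.fun_sum fun F _ => ?_
  have h := ((hasDerivAt_id t).mul_const (Z F)).exp.const_mul (edgeWeight p E F)
  refine h.congr_deriv ?_
  simp only [id]
  ring

/-- Lemma 4.7. For a set `A ⊆ V`, let `g(A)` be the random variable
`g(A) = |A| + |MVC(G*[V \ A])|`, where `G*[V \ A]` is the induced subgraph of the
realized graph `G*` on `V \ A`. Then for any set `S ⊆ V` and any `ε ∈ [0,1]`,
`Pr[|g(S) − E[g(S)]| > ε·E[g(S)]] ≤ 2·exp(−ε²·opt/66)`. -/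
theorem g_concentration
    (G : SimpleGraph V) [DecidableRel G.Adj]
    (p : ℝ) (hp0 : 0 < p) (hp1 : p ≤ 1)
    (MVC : Finset (Sym2 V) → Finset V)
    (hMVC : IsMinCoverFn G.edgeFinset MVC)
    (opt : ℝ) (hopt : opt = optVal p G.edgeFinset MVC)
    (S : Finset V) (ε : ℝ) (hε0 : 0 ≤ ε) (hε1 : ε ≤ 1)
    (g : Finset (Sym2 V) → ℝ)
    (hg : g = fun F =>
      (S.card : ℝ) + ((MVC (F.filter fun e => ∀ v ∈ e, v ∉ S)).card : ℝ)) :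
    probEvent p G.edgeFinset
        (fun F => ε * expVal p G.edgeFinset g < |g F - expVal p G.edgeFinset g|) ≤
      2 * Real.exp (-(ε ^ 2 * opt) / 66) := by
  set E := G.edgeFinset with hE
  set Z : Finset (Sym2 V) → ℝ :=
    fun F => ((MVC (F.filter fun e => ∀ v ∈ e, v ∉ S)).card : ℝ) with hZ
  have hp0' := hp0.le
  have hZ0 : ∀ F, 0 ≤ Z F := fun F => Nat.cast_nonneg _
  set m := expVal p E Z with hm
  have hm0 : 0 ≤ m := by
    have := expVal_mono hp0' hp1 E (X := fun _ => 0) (Y := Z) (fun F _ => hZ0 F)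
    rwa [expVal_const] at this
  have hEg : expVal p E g = S.card + m := by
    rw [hg, expVal_add, expVal_const]
  have hoptle : opt ≤ S.card + m := by
    rw [hopt, ← hEg, hg]
    refine expVal_mono hp0' hp1 E fun F hF => ?_
    have hF' : (F.filter fun e => ∀ v ∈ e, v ∉ S) ⊆ E := (Finset.filter_subset _ _).trans hF
    have h1 := (hMVC F hF).2 (S ∪ MVC (F.filter fun e => ∀ v ∈ e, v ∉ S)) (by
      intro e he
      by_cases h : ∀ v ∈ e, v ∉ S
      · obtain ⟨v, hv, hve⟩ := (hMVC _ hF').1 e (Finset.mem_filter.2 ⟨he, h⟩)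
        exact ⟨v, Finset.mem_union_right _ hv, hve⟩
      · push Not at h
        obtain ⟨v, hve, hv⟩ := h
        exact ⟨v, Finset.mem_union_left _ hv, hve⟩)
    have h2 := h1.trans (Finset.card_union_le _ _)
    exact_mod_cast h2
  set μ : ℝ := S.card + m with hμ
  have hmμ : m ≤ μ := by
    have : (0 : ℝ) ≤ S.card := Nat.cast_nonneg _
    linarith
  rw [hEg]
  rcases hε0.eq_or_lt with rfl | hε
  · have h1 : probEvent p E (fun F => 0 * μ < |g F - μ|) ≤ expVal p E (fun _ => 1) := by
      unfold probEvent expVal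
      refine Finset.sum_le_sum fun F _ => ?_
      have := edgeWeight_nonneg' hp0' hp1 E F
      split_ifs <;> linarith
    rw [expVal_const] at h1
    refine h1.trans ?_
    norm_num
  -- orientation of the edges
  set own : Sym2 V → V := fun e => e.out.1 with hown
  have hown' : ∀ e, own e ∈ e := fun e => Sym2.out_fst_mem e
  have hcomm : ∀ (F : Finset (Sym2 V)) v,
      (F.filter fun e => own e ≠ v).filter (fun e => ∀ v ∈ e, v ∉ S) =
      (F.filter (fun e => ∀ v ∈ e, v ∉ S)).filter fun e => own e ≠ v :=
    fun F v => Finset.filter_comm _ _ _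
  have hsb : ∀ F ⊆ E, _ := fun F hF => self_bounding E MVC hMVC own hown'
    (F.filter fun e => ∀ v ∈ e, v ∉ S) ((Finset.filter_subset _ _).trans hF)
  have hent := ent_bound hp0' hp1 E own Z
    (by
      intro F hF v
      obtain ⟨h1, h2⟩ := (hsb F hF).1 v
      simp only [hZ, hcomm]
      exact ⟨by exact_mod_cast h1, by exact_mod_cast h2⟩)
    (by
      intro F hF
      have h1 := (hsb F hF).2
      simp only [hZ, hcomm]
      exact h1)
  have hMpos : ∀ t, 0 < expVal p E (fun F => Real.exp (t * Z F)) :=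
    fun t => expVal_pos hp0' hp1 E fun F => Real.exp_pos _
  have hh := herbst_abs (fun t => expVal p E (fun F => Real.exp (t * Z F)))
    (fun t => expVal p E (fun F => Z F * Real.exp (t * Z F)))
    (fun t => mgf_hasDerivAt p E Z t) hMpos
    (by
      intro t
      have := expVal_mono hp0' hp1 E (X := fun _ => 0) (Y := fun F => Z F * Real.exp (t * Z F))
        (fun F _ => mul_nonneg (hZ0 F) (Real.exp_pos _).le)
      rwa [expVal_const] at this)
    (by simp [expVal_const]) hent (ε / 8) (by linarith) (by linarith)
  simp only [zero_mul, Real.exp_zero, mul_one] at hh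
  rw [← hm] at hh
  obtain ⟨hu, hl⟩ := hh
  rw [Real.log_le_iff_le_exp (hMpos _)] at hu hl
  set s := ε / 8 with hs
  have hspos : 0 < s := by rw [hs]; linarith
  have hprob : probEvent p E (fun F => ε * μ < |g F - μ|) ≤
      expVal p E (fun F => Real.exp (-(s * (ε * μ)) - s * m) * Real.exp (s * Z F) +
        Real.exp (-(s * (ε * μ)) + s * m) * Real.exp (-s * Z F)) := by
    unfold probEvent expVal
    refine Finset.sum_le_sum fun F _ => ?_
    have hw := edgeWeight_nonneg' hp0' hp1 E F
    split_ifs with h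
    · refine le_mul_of_one_le_right hw ?_
      have hgm : g F - μ = Z F - m := by
        rw [hg]
        simp only [hμ, hZ]
        ring
      beta_reduce at h ⊢
      rw [hgm] at h
      rw [← Real.exp_add, ← Real.exp_add]
      rcases lt_abs.1 h with h | h
      · have h1 := Real.one_le_exp (x := -(s * (ε * μ)) - s * m + s * Z F) (by nlinarith)
        have h2 := Real.exp_pos (-(s * (ε * μ)) + s * m + -s * Z F)
        linarith
      · have h1 := Real.one_le_exp (x := -(s * (ε * μ)) + s * m + -s * Z F) (by nlinarith)
        have h2 := Real.exp_pos (-(s * (ε * μ)) - s * m + s * Z F)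
        linarith
    · positivity
  refine hprob.trans ?_
  rw [expVal_add, expVal_smul, expVal_smul]
  have hfin : -(s * (ε * μ)) + 8 / 3 * s ^ 2 * m ≤ -(ε ^ 2 * opt) / 66 := by
    rw [hs]
    have h1 : 0 ≤ ε ^ 2 * (μ - m) := mul_nonneg (sq_nonneg _) (by linarith)
    have h2 : 0 ≤ ε ^ 2 * (μ - opt) := mul_nonneg (sq_nonneg _) (by linarith)
    have h3 : 0 ≤ ε ^ 2 * m := mul_nonneg (sq_nonneg _) hm0
    nlinarith
  have a1 := mul_le_mul_of_nonneg_left hu (Real.exp_pos (-(s * (ε * μ)) - s * m)).le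
  have a2 := mul_le_mul_of_nonneg_left hl (Real.exp_pos (-(s * (ε * μ)) + s * m)).le
  rw [← Real.exp_add] at a1 a2
  have b1 := a1.trans (Real.exp_le_exp.2 (show _ ≤ -(ε ^ 2 * opt) / 66 by linarith))
  have b2 := a2.trans (Real.exp_le_exp.2 (show _ ≤ -(ε ^ 2 * opt) / 66 by linarith))
  linarith
end
end

section
/- Let ε ∈ (0,1), n ≥ 6, and γ = ε⁵/10³. Let Q ⊆ M be any set of vertices, let F be the set of edges of G with at least one endpoint in Q, and let F* ⊆ F and Q_VC ⊆ Q be arbitrary. Define DECIDED(Q_VC, F*) = {u ∈ M \ Q : there exists an edge (u,v) ∈ F* with v ∈ Q \ Q_VC}, UNDECIDED(Q_VC, F*) = M \ (Q ∪ DECIDED(Q_VC, F*)), A(Q_VC, F*) = {u ∈ M \ Q : u has at least 1/(p·γ) neighbors in G[M] belonging to UNDECIDED(Q_VC, F*)}, and SEED(Q_VC, F*) = L ∪ Q ∪ DECIDED(Q_VC, F*) ∪ A(Q_VC, F*). Then the induced subgraph G[V \ SEED(Q_VC, F*)] has at most 2·10³·n/(p·ε⁵) edges. -/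
open Finset

noncomputable section
open scoped Classical

variable {V : Type*} [Fintype V] [DecidableEq V]

lemma aux_w_nonneg (p : ℝ) (hp0 : 0 < p) (hp1 : p ≤ 1) (E F : Finset (Sym2 V)) :
    0 ≤ edgeWeight p E F := by
  unfold edgeWeight
  have : 0 ≤ 1 - p := by linarith
  positivity

lemma aux_avoid (p : ℝ) (E D : Finset (Sym2 V)) (hD : D ⊆ E) :
    ∑ F ∈ (E \ D).powerset, edgeWeight p E F = (1 - p) ^ D.card := by
  have h := Finset.sum_pow_mul_eq_add_pow p (1 - p) (E \ D)
  have h2 : ∀ F ∈ (E \ D).powerset, edgeWeight p E F =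
      (p ^ F.card * (1 - p) ^ ((E \ D).card - F.card)) * (1 - p) ^ D.card := by
    intro F hF
    rw [Finset.mem_powerset] at hF
    unfold edgeWeight
    rw [mul_assoc, ← pow_add]
    congr 2
    have h1 : F ⊆ E := hF.trans Finset.sdiff_subset
    have a1 := Finset.card_sdiff_of_subset h1
    have a2 := Finset.card_sdiff_of_subset hD
    have a3 := Finset.card_le_card hF
    have a4 := Finset.card_le_card hD
    omega
  rw [Finset.sum_congr rfl h2, ← Finset.sum_mul, h]
  simp

lemma aux_total (p : ℝ) (E : Finset (Sym2 V)) :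
    ∑ F ∈ E.powerset, edgeWeight p E F = 1 := by
  have := aux_avoid p E ∅ (Finset.empty_subset _)
  simpa using this

def auxUnc (E : Finset (Sym2 V)) (C : Finset V) : Finset (Sym2 V) :=
  E.filter fun e => ∀ v ∈ e, v ∉ C

lemma aux_cover (p : ℝ) (hp0 : 0 < p) (hp1 : p ≤ 1) (E : Finset (Sym2 V)) (C : Finset V) :
    ∑ F ∈ E.powerset, (if IsCoverOf C F then
      edgeWeight p E F * Real.exp (p * (auxUnc E C).card) else 0) ≤ 1 := by
  have hD : auxUnc E C ⊆ E := Finset.filter_subset _ _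
  rw [← Finset.sum_filter]
  calc _ ≤ ∑ F ∈ (E \ auxUnc E C).powerset,
        edgeWeight p E F * Real.exp (p * (auxUnc E C).card) := by
        apply Finset.sum_le_sum_of_subset_of_nonneg
        · intro F hF
          rw [Finset.mem_filter, Finset.mem_powerset] at hF
          rw [Finset.mem_powerset]
          intro e he
          rw [Finset.mem_sdiff]
          refine ⟨hF.1 he, fun h => ?_⟩
          obtain ⟨v, hv, hve⟩ := hF.2 e he
          exact (Finset.mem_filter.1 h).2 v hve hv
        · intro F _ _
          exact mul_nonneg (aux_w_nonneg p hp0 hp1 E F) (Real.exp_pos _).le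
    _ = (1 - p) ^ (auxUnc E C).card * Real.exp (p * (auxUnc E C).card) := by
        rw [← Finset.sum_mul, aux_avoid p E _ hD]
    _ ≤ (Real.exp (-p)) ^ (auxUnc E C).card * Real.exp (p * (auxUnc E C).card) := by
        have h1 := Real.add_one_le_exp (-p)
        have h0 : 0 ≤ 1 - p := by linarith
        exact mul_le_mul_of_nonneg_right (pow_le_pow_left₀ h0 (by linarith) _)
          (Real.exp_pos _).le
    _ = 1 := by
        rw [← Real.exp_nat_mul, ← Real.exp_add]
        simp; ring

lemma aux_exp (p : ℝ) (hp0 : 0 < p) (hp1 : p ≤ 1) (E : Finset (Sym2 V))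
    (MVC : Finset (Sym2 V) → Finset V) (h : IsMinCoverFn E MVC) :
    ∑ F ∈ E.powerset, edgeWeight p E F * Real.exp (p * (auxUnc E (MVC F)).card)
      ≤ 2 ^ Fintype.card V := by
  calc _ ≤ ∑ F ∈ E.powerset, ∑ C : Finset V, (if IsCoverOf C F then
      edgeWeight p E F * Real.exp (p * (auxUnc E C).card) else 0) := by
        apply Finset.sum_le_sum
        intro F hF
        have hc := (h F (Finset.mem_powerset.1 hF)).1
        have := Finset.single_le_sum (s := Finset.univ) (f := fun C : Finset V =>
          if IsCoverOf C F then
            edgeWeight p E F * Real.exp (p * (auxUnc E C).card) else 0)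
          (fun C _ => by
            split_ifs
            · exact mul_nonneg (aux_w_nonneg p hp0 hp1 E F) (Real.exp_pos _).le
            · exact le_rfl) (Finset.mem_univ (MVC F))
        simpa [hc] using this
    _ = ∑ C : Finset V, ∑ F ∈ E.powerset, (if IsCoverOf C F then
      edgeWeight p E F * Real.exp (p * (auxUnc E C).card) else 0) := Finset.sum_comm
    _ ≤ ∑ C : Finset V, 1 := Finset.sum_le_sum fun C _ => aux_cover p hp0 hp1 E C
    _ = _ := by simp

lemma aux_unc (p : ℝ) (hp0 : 0 < p) (hp1 : p ≤ 1) (E : Finset (Sym2 V))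
    (MVC : Finset (Sym2 V) → Finset V) (h : IsMinCoverFn E MVC) :
    p * ∑ F ∈ E.powerset, edgeWeight p E F * (auxUnc E (MVC F)).card
      ≤ Fintype.card V + 1 := by
  set n : ℝ := (Fintype.card V : ℝ) with hn
  calc _ = ∑ F ∈ E.powerset, edgeWeight p E F * (p * (auxUnc E (MVC F)).card) := by
        rw [Finset.mul_sum]; exact Finset.sum_congr rfl fun _ _ => by ring
    _ ≤ ∑ F ∈ E.powerset, (edgeWeight p E F * n +
          edgeWeight p E F * Real.exp (p * (auxUnc E (MVC F)).card) * Real.exp (-n)) := by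
        apply Finset.sum_le_sum
        intro F _
        rw [mul_assoc, ← Real.exp_add, ← mul_add]
        apply mul_le_mul_of_nonneg_left _ (aux_w_nonneg p hp0 hp1 E F)
        have := Real.add_one_le_exp (p * (auxUnc E (MVC F)).card + -n)
        linarith
    _ = n + (∑ F ∈ E.powerset, edgeWeight p E F *
          Real.exp (p * (auxUnc E (MVC F)).card)) * Real.exp (-n) := by
        rw [Finset.sum_add_distrib, ← Finset.sum_mul, ← Finset.sum_mul, aux_total, one_mul]
    _ ≤ n + (2 : ℝ) ^ Fintype.card V * Real.exp (-n) := by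
        have := aux_exp p hp0 hp1 E MVC h
        gcongr
    _ ≤ n + (Real.exp 1) ^ Fintype.card V * Real.exp (-n) := by
        have := Real.add_one_le_exp (1 : ℝ)
        gcongr
        linarith
    _ = n + 1 := by
        rw [← Real.exp_nat_mul, ← Real.exp_add, ← hn]; simp

lemma aux_T (p : ℝ) (hp0 : 0 < p) (hp1 : p ≤ 1) (E : Finset (Sym2 V))
    (MVC : Finset (Sym2 V) → Finset V) (h : IsMinCoverFn E MVC) (ε : ℝ)
    (T : Finset (Sym2 V)) (hT : T ⊆ E)
    (hTe : ∀ e ∈ T, ε ≤ probEvent p E fun F => ∀ v ∈ e, v ∉ MVC F) :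
    p * (ε * T.card) ≤ Fintype.card V + 1 := by
  refine le_trans (mul_le_mul_of_nonneg_left ?_ hp0.le) (aux_unc p hp0 hp1 E MVC h)
  calc ε * T.card = ∑ e ∈ T, ε := by simp [mul_comm]
    _ ≤ ∑ e ∈ T, probEvent p E (fun F => ∀ v ∈ e, v ∉ MVC F) := Finset.sum_le_sum hTe
    _ = ∑ F ∈ E.powerset, ∑ e ∈ T,
          if (∀ v ∈ e, v ∉ MVC F) then edgeWeight p E F else 0 := by
        simp only [probEvent]
        rw [Finset.sum_comm]
        refine Finset.sum_congr rfl fun F _ => Finset.sum_congr rfl fun e _ => ?_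
        congr
    _ ≤ _ := by
        apply Finset.sum_le_sum
        intro F _
        rw [← Finset.sum_filter, Finset.sum_const, nsmul_eq_mul, mul_comm]
        apply mul_le_mul_of_nonneg_left _ (aux_w_nonneg p hp0 hp1 E F)
        exact_mod_cast Finset.card_le_card (Finset.filter_subset_filter _ hT)

lemma aux_edge (p : ℝ) (hp0 : 0 < p) (hp1 : p ≤ 1) (E : Finset (Sym2 V))
    (MVC : Finset (Sym2 V) → Finset V) (u v : V) :
    1 - (probEvent p E fun F => u ∈ MVC F) - (probEvent p E fun F => v ∈ MVC F)
      ≤ probEvent p E fun F => ∀ w ∈ s(u, v), w ∉ MVC F := by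
  rw [← aux_total p E]
  unfold probEvent
  rw [← Finset.sum_sub_distrib, ← Finset.sum_sub_distrib]
  apply Finset.sum_le_sum
  intro F _
  have := aux_w_nonneg p hp0 hp1 E F
  by_cases h1 : u ∈ MVC F <;> by_cases h2 : v ∈ MVC F <;> simp [h1, h2, this]

/-- Lemma 4.8. Let `ε ∈ (0,1)`, `n ≥ 6`, `γ = ε⁵/10³`. Let `Q ⊆ M`,
`F` the set of edges of `G` with at least one endpoint in `Q`, and `F* ⊆ F`,
`Q_VC ⊆ Q` arbitrary. With
`DECIDED(Q_VC, F*) = {u ∈ M \ Q : ∃ (u,v) ∈ F* with v ∈ Q \ Q_VC}`,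
`UNDECIDED(Q_VC, F*) = M \ (Q ∪ DECIDED(Q_VC, F*))`,
`A(Q_VC, F*) = {u ∈ M \ Q : u has ≥ 1/(p·γ) neighbors in G[M] in UNDECIDED(Q_VC, F*)}`,
`SEED(Q_VC, F*) = L ∪ Q ∪ DECIDED(Q_VC, F*) ∪ A(Q_VC, F*)`,
the induced subgraph `G[V \ SEED(Q_VC, F*)]` has at most `2·10³·n/(p·ε⁵)` edges. -/
theorem seed_complement_sparse
    (G : SimpleGraph V) [DecidableRel G.Adj]
    (p : ℝ) (hp0 : 0 < p) (hp1 : p ≤ 1)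
    (MVC : Finset (Sym2 V) → Finset V)
    (hMVC : IsMinCoverFn G.edgeFinset MVC)
    (ε : ℝ) (hε0 : 0 < ε) (hε1 : ε < 1)
    (hn : 6 ≤ Fintype.card V)
    (γ : ℝ) (hγ : γ = ε ^ 5 / 10 ^ 3)
    (L M : Finset V)
    (hL : L = Finset.univ.filter fun v =>
      1 - 2 * ε ≤ probEvent p G.edgeFinset fun F => v ∈ MVC F)
    (hM : M = Finset.univ.filter fun v =>
      ε < probEvent p G.edgeFinset (fun F => v ∈ MVC F) ∧
      probEvent p G.edgeFinset (fun F => v ∈ MVC F) < 1 - 2 * ε)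
    (Q : Finset V) (hQ : Q ⊆ M)
    (Fstar : Finset (Sym2 V))
    (hFstar : Fstar ⊆ G.edgeFinset.filter fun e => ∃ u ∈ e, u ∈ Q)
    (Qvc : Finset V) (hQvc : Qvc ⊆ Q)
    (decided undecided A seed : Finset V)
    (hdecided : decided = (M \ Q).filter fun u => ∃ v ∈ Q \ Qvc, s(u, v) ∈ Fstar)
    (hundecided : undecided = M \ (Q ∪ decided))
    (hA : A = (M \ Q).filter fun u =>
      1 / (p * γ) ≤ (((G.neighborFinset u ∩ M) ∩ undecided).card : ℝ))
    (hseed : seed = L ∪ Q ∪ decided ∪ A) :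
    (inducedEdgeCount G seed : ℝ) ≤ 2 * 10 ^ 3 * Fintype.card V / (p * ε ^ 5) := by
  have hn0 : (6 : ℝ) ≤ Fintype.card V := by exact_mod_cast hn
  set P : V → ℝ := fun v => probEvent p G.edgeFinset (fun F => v ∈ MVC F) with hP
  have hpe : 0 < p * ε ^ 5 := by positivity
  have hsub : (G.edgeFinset.filter fun e => ∀ v ∈ e, v ∉ seed) ⊆
      (G.edgeFinset.filter fun e => ε ≤ probEvent p G.edgeFinset fun F => ∀ v ∈ e, v ∉ MVC F) ∪
      ((M \ seed).biUnion fun u =>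
        ((G.neighborFinset u ∩ M) ∩ undecided).image fun v => s(u, v)) := by
    intro e he
    rw [Finset.mem_filter] at he
    obtain ⟨heE, hes⟩ := he
    induction e with
    | h u v =>
    have hadj : G.Adj u v := by simpa using heE
    have hu : u ∉ seed := hes u (by simp)
    have hv : v ∉ seed := hes v (by simp)
    have huL : P u < 1 - 2 * ε := by
      by_contra hc
      exact hu (by simp only [hseed, hL, Finset.mem_union, Finset.mem_filter, Finset.mem_univ, true_and]; exact Or.inl (Or.inl (Or.inl (not_lt.1 hc))))
    have hvL : P v < 1 - 2 * ε := by
      by_contra hc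
      exact hv (by simp only [hseed, hL, Finset.mem_union, Finset.mem_filter, Finset.mem_univ, true_and]; exact Or.inl (Or.inl (Or.inl (not_lt.1 hc))))
    rw [Finset.mem_union]
    by_cases hb : ε < P u ∧ ε < P v
    · right
      have huM : u ∈ M := by rw [hM, Finset.mem_filter]; exact ⟨Finset.mem_univ _, hb.1, huL⟩
      have hvM : v ∈ M := by rw [hM, Finset.mem_filter]; exact ⟨Finset.mem_univ _, hb.2, hvL⟩
      have hvU : v ∈ undecided := by
        rw [hundecided]
        rw [hseed] at hv
        simp only [Finset.mem_union, Finset.mem_sdiff, not_or] at hv ⊢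
        exact ⟨hvM, hv.1.1.2, hv.1.2⟩
      rw [Finset.mem_biUnion]
      refine ⟨u, Finset.mem_sdiff.2 ⟨huM, hu⟩, Finset.mem_image.2 ⟨v, ?_, rfl⟩⟩
      simp [hadj, hvM, hvU]
    · left
      rw [Finset.mem_filter]
      refine ⟨heE, le_trans ?_ (aux_edge p hp0 hp1 _ MVC u v)⟩
      change ε ≤ 1 - P u - P v
      by_cases hb1 : ε < P u
      · have : P v ≤ ε := not_lt.1 fun h => hb ⟨hb1, h⟩
        linarith
      · linarith
  have hT := aux_T p hp0 hp1 G.edgeFinset MVC hMVC ε _ (Finset.filter_subset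
    (fun e => ε ≤ probEvent p G.edgeFinset fun F => ∀ v ∈ e, v ∉ MVC F) _) (fun e he =>
      (Finset.mem_filter.1 he).2)
  set T := G.edgeFinset.filter fun e =>
    ε ≤ probEvent p G.edgeFinset fun F => ∀ v ∈ e, v ∉ MVC F with hTdef
  have hT' : (T.card : ℝ) ≤ 10 ^ 3 * Fintype.card V / (p * ε ^ 5) := by
    rw [le_div_iff₀ hpe]
    have h4 : ε ^ 4 ≤ 1 := pow_le_one₀ hε0.le hε1.le
    have h0 : 0 ≤ p * (ε * T.card) := by positivity
    calc (T.card : ℝ) * (p * ε ^ 5) = (p * (ε * T.card)) * ε ^ 4 := by ring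
      _ ≤ (p * (ε * T.card)) * 1 := by gcongr
      _ ≤ _ := by linarith
  have hB : ((((M \ seed).biUnion fun u =>
        ((G.neighborFinset u ∩ M) ∩ undecided).image fun v => s(u, v))).card : ℝ)
        ≤ 10 ^ 3 * Fintype.card V / (p * ε ^ 5) := by
    calc _ ≤ ∑ u ∈ M \ seed, (((G.neighborFinset u ∩ M) ∩ undecided).card : ℝ) := by
          have := (Finset.card_biUnion_le (s := M \ seed) (t := fun u =>
            ((G.neighborFinset u ∩ M) ∩ undecided).image fun v => s(u, v))).trans
            (Finset.sum_le_sum fun u _ => Finset.card_image_le)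
          exact_mod_cast this
      _ ≤ ∑ u ∈ M \ seed, 1 / (p * γ) := by
          apply Finset.sum_le_sum
          intro u hu
          by_contra hc
          rw [Finset.mem_sdiff] at hu
          apply hu.2
          rw [hseed]
          by_cases huQ : u ∈ Q
          · simp [huQ]
          · rw [Finset.mem_union]
            right
            rw [hA, Finset.mem_filter]
            exact ⟨Finset.mem_sdiff.2 ⟨hu.1, huQ⟩, (not_le.1 hc).le⟩
      _ = ((M \ seed).card : ℝ) * (10 ^ 3 / (p * ε ^ 5)) := by
          rw [Finset.sum_const, nsmul_eq_mul, hγ]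
          congr 1
          field_simp
      _ ≤ (Fintype.card V : ℝ) * (10 ^ 3 / (p * ε ^ 5)) := by
          gcongr
          exact Finset.card_le_univ _
      _ = _ := by ring
  have hcard : (inducedEdgeCount G seed : ℝ) ≤ T.card + (((M \ seed).biUnion fun u =>
        ((G.neighborFinset u ∩ M) ∩ undecided).image fun v => s(u, v))).card := by
    have := (Finset.card_le_card hsub).trans (Finset.card_union_le _ _)
    unfold inducedEdgeCount
    exact_mod_cast this
  calc _ ≤ _ := hcard
    _ ≤ _ := add_le_add hT' hB
    _ = _ := by ring
end
end
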